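/- Every smooth projective curve over an algebraically closed field can be embedded in P^3. -/

import Mathlib

open MvPolynomial

variable {k : Type} [Field k]

/-- Iterated partial derivatives along a list of variable indices. -/
noncomputable def pderivList {n : ℕ} (s : List (Fin n)) (F : MvPolynomial (Fin n) k) :
    MvPolynomial (Fin n) k :=
  s.foldr (fun i G => pderiv i G) F

/-- The `m`-th directional derivative of `F` at `v` in direction `w`
(`m!` times the degree-`m` Taylor form). -/
noncomputable def dirDeriv {n : ℕ} (F : MvPolynomial (Fin n) k)
    (v w : Fin n → k) (m : ℕ) : k :=
  ∑ s : Fin m → Fin n, eval v (pderivList (List.ofFn s) F) * ∏ j, w (s j)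

/-- `F` has multiplicity (exactly) `m` at the point `v`: all partial derivatives of
order `< m` vanish at `v`, while some order-`m` derivative does not. -/
def HasMultiplicityAt {n : ℕ} (F : MvPolynomial (Fin n) k) (v : Fin n → k) (m : ℕ) : Prop :=
  (∀ s : List (Fin n), s.length < m → eval v (pderivList s F) = 0) ∧
    ∃ s : List (Fin n), s.length = m ∧ eval v (pderivList s F) ≠ 0

/-- A singular point of the projective plane curve `F = 0`. -/
def IsSingularAt (F : MvPolynomial (Fin 3) k) (v : Fin 3 → k) : Prop :=
  v ≠ 0 ∧ eval v F = 0 ∧ ∀ i, eval v (pderiv i F) = 0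

/-- A node (ordinary double point): multiplicity two with two distinct tangent
directions, i.e. the degree-2 tangent cone is not (a multiple of) a square of a linear form. -/
def IsNodeAt (F : MvPolynomial (Fin 3) k) (v : Fin 3 → k) : Prop :=
  v ≠ 0 ∧ eval v F = 0 ∧ HasMultiplicityAt F v 2 ∧
    ¬ ∃ (c : k) (l : Fin 3 → k), ∀ w : Fin 3 → k,
        dirDeriv F v w 2 = c * (∑ i, l i * w i) ^ 2

/-- An ordinary point of multiplicity `m`: the degree-`m` tangent cone factors into `m`
pairwise distinct linear forms. -/
def IsOrdinaryAt (F : MvPolynomial (Fin 3) k) (v : Fin 3 → k) (m : ℕ) : Prop :=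
  HasMultiplicityAt F v m ∧
    ∃ (c : k) (L : Fin m → (Fin 3 → k)), c ≠ 0 ∧
      (∀ i j, i ≠ j → ¬ ∃ t : k, L j = t • L i) ∧
      ∀ w : Fin 3 → k, dirDeriv F v w m = c * ∏ i, (∑ j, L i j * w j)

/-- An (irreducible) plane algebraic curve of degree `n` in `ℙ²`. -/
structure PlaneCurve (k : Type) [Field k] where
  n : ℕ
  F : MvPolynomial (Fin 3) k
  homog : F.IsHomogeneous n
  irred : Irreducible F

/-- Birational equivalence of the projective curves `F = 0` and `G = 0`, expressed by a
pair of mutually inverse rational maps given by homogeneous polynomial triples. -/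
def BirEquiv (F G : MvPolynomial (Fin 3) k) : Prop :=
  ∃ φ ψ : Fin 3 → MvPolynomial (Fin 3) k,
    (∃ d, ∀ i, (φ i).IsHomogeneous d) ∧
    (∃ e, ∀ i, (ψ i).IsHomogeneous e) ∧
    bind₁ φ G ∈ Ideal.span {F} ∧
    bind₁ ψ F ∈ Ideal.span {G} ∧
    (∃ lam : MvPolynomial (Fin 3) k, lam ∉ Ideal.span {F} ∧
      ∀ i, bind₁ φ (ψ i) - lam * X i ∈ Ideal.span {F}) ∧
    (∃ mu : MvPolynomial (Fin 3) k, mu ∉ Ideal.span {G} ∧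
      ∀ i, bind₁ ψ (φ i) - mu * X i ∈ Ideal.span {G})


/-- The (affine cone over the) zero locus in `ℙ^{N-1}` of an ideal of polynomials. -/
def projZeros {k : Type} [Field k] {N : ℕ} (I : Ideal (MvPolynomial (Fin N) k)) :
    Set (Fin N → k) :=
  {v | ∀ f ∈ I, eval v f = 0}

/-- The (cone over the) Zariski tangent space of `V(I)` at `v`. -/
noncomputable def tangentSpace {k : Type} [Field k] {N : ℕ}
    (I : Ideal (MvPolynomial (Fin N) k)) (v : Fin N → k) : Submodule k (Fin N → k) :=
  ⨅ f ∈ I, LinearMap.ker (∑ i, eval v (pderiv i f) • (LinearMap.proj i : (Fin N → k) →ₗ[k] k))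

/-- `I` defines an irreducible curve in `ℙ^{N-1}`: it is a homogeneous prime ideal whose
affine cone has Krull dimension 2. -/
structure IsProjCurveIdeal {k : Type} [Field k] {N : ℕ}
    (I : Ideal (MvPolynomial (Fin N) k)) : Prop where
  prime : I.IsPrime
  homog : ∃ S : Set (MvPolynomial (Fin N) k), I = Ideal.span S ∧
    ∀ g ∈ S, ∃ d, g.IsHomogeneous d
  dim : ringKrullDim (MvPolynomial (Fin N) k ⧸ I) = 2

/-- `v` is a singular point of the curve `V(I)` (the tangent space is too big). -/
def IsSingularCurvePoint {k : Type} [Field k] {N : ℕ}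
    (I : Ideal (MvPolynomial (Fin N) k)) (v : Fin N → k) : Prop :=
  v ≠ 0 ∧ v ∈ projZeros I ∧ Module.finrank k (tangentSpace I v) ≠ 2

/-- The curve `V(I)` is smooth. -/
def IsSmoothCurve {k : Type} [Field k] {N : ℕ}
    (I : Ideal (MvPolynomial (Fin N) k)) : Prop :=
  ∀ v ∈ projZeros I, v ≠ 0 → Module.finrank k (tangentSpace I v) = 2

/-- The line `W` (a 2-dimensional subspace of `k⁴`) is a secant of `V(I)`:
it meets the curve in at least two distinct points of `ℙ³`. -/
def IsSecantOf {k : Type} [Field k] (I : Ideal (MvPolynomial (Fin 4) k))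
    (W : Submodule k (Fin 4 → k)) : Prop :=
  Module.finrank k W = 2 ∧ ∃ v₁ v₂ : Fin 4 → k,
    v₁ ≠ 0 ∧ v₂ ≠ 0 ∧ v₁ ∈ W ∧ v₂ ∈ W ∧ v₁ ∈ projZeros I ∧ v₂ ∈ projZeros I ∧
      ¬ ∃ c : k, v₂ = c • v₁

/-- The line `W` is a trisecant of `V(I)`: it meets the curve in at least three distinct
points of `ℙ³`. -/
def IsTrisecantOf {k : Type} [Field k] (I : Ideal (MvPolynomial (Fin 4) k))
    (W : Submodule k (Fin 4 → k)) : Prop :=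
  Module.finrank k W = 2 ∧ ∃ v₁ v₂ v₃ : Fin 4 → k,
    v₁ ≠ 0 ∧ v₂ ≠ 0 ∧ v₃ ≠ 0 ∧ v₁ ∈ W ∧ v₂ ∈ W ∧ v₃ ∈ W ∧
    v₁ ∈ projZeros I ∧ v₂ ∈ projZeros I ∧ v₃ ∈ projZeros I ∧
    (¬ ∃ c : k, v₂ = c • v₁) ∧ (¬ ∃ c : k, v₃ = c • v₁) ∧ (¬ ∃ c : k, v₃ = c • v₂)

/-- The line `W` is tangent to `V(I)` at some point. -/
def IsTangentLineOf {k : Type} [Field k] (I : Ideal (MvPolynomial (Fin 4) k))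
    (W : Submodule k (Fin 4 → k)) : Prop :=
  Module.finrank k W = 2 ∧ ∃ v : Fin 4 → k,
    v ≠ 0 ∧ v ∈ projZeros I ∧ v ∈ W ∧ W ≤ tangentSpace I v

/-- Birational equivalence between the projective varieties `V(I) ⊆ ℙ^{N-1}` and
`V(J) ⊆ ℙ^{M-1}`, given by mutually inverse rational maps with homogeneous polynomial
components. -/
def IdealBirEquiv {k : Type} [Field k] {N M : ℕ}
    (I : Ideal (MvPolynomial (Fin N) k)) (J : Ideal (MvPolynomial (Fin M) k)) : Prop :=
  ∃ (φ : Fin M → MvPolynomial (Fin N) k) (ψ : Fin N → MvPolynomial (Fin M) k),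
    (∃ d, ∀ i, (φ i).IsHomogeneous d) ∧ (∃ e, ∀ i, (ψ i).IsHomogeneous e) ∧
    (∀ g ∈ J, bind₁ φ g ∈ I) ∧ (∀ f ∈ I, bind₁ ψ f ∈ J) ∧
    (∃ lam, lam ∉ I ∧ ∀ i, bind₁ φ (ψ i) - lam * X i ∈ I) ∧
    (∃ mu, mu ∉ J ∧ ∀ i, bind₁ ψ (φ i) - mu * X i ∈ J)


/-! ### Helper lemmas -/

theorem aux_krullDim_integral {R S : Type*} [CommRing R] [CommRing S] (f : R →+* S)
    (hf : Function.Injective f) (hi : f.IsIntegral) : ringKrullDim R = ringKrullDim S := by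
  let := f.toAlgebra
  have hint : Algebra.IsIntegral R S := ⟨hi⟩
  have : FaithfulSMul R S := (faithfulSMul_iff_algebraMap_injective R S).mpr hf
  apply le_antisymm
  · unfold ringKrullDim Order.krullDim
    apply iSup_le
    intro l
    obtain ⟨⟨P, hP, hPl⟩⟩ := Ideal.nonempty_primesOver (S := S) (RelSeries.head l).asIdeal
    obtain ⟨L, hL, -⟩ := Ideal.exists_ltSeries_of_hasGoingUp l P
    rw [← hL]
    exact le_iSup (fun p : LTSeries (PrimeSpectrum S) => ((p.length : ℕ∞) : WithBot ℕ∞)) L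
  · apply Order.krullDim_le_of_strictMono (PrimeSpectrum.comap (algebraMap R S))
    intro P Q hPQ
    exact Ideal.IsIntegral.comap_lt_comap (R := R) (show P.asIdeal < Q.asIdeal from hPQ)

theorem aux_dependent {A : Type} [CommRing A] [IsDomain A] [Algebra k A] (b : Fin 4 → A)
    (G : Set A) (hG : Algebra.adjoin k G = ⊤)
    (hint : ∀ g ∈ G, IsIntegral (Algebra.adjoin k (Set.range b)) g)
    (m : ℕ) (hm : 5 ≤ m) (w : Fin m → A) :
    ∃ F : MvPolynomial (Fin m) k, F ≠ 0 ∧ aeval w F = 0 := by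
  by_contra hcon
  push Not at hcon
  have hind : AlgebraicIndependent k w := by
    rw [algebraicIndependent_iff]
    intro F hF
    by_contra h
    exact hcon F h hF
  have hall : ∀ a : A, IsIntegral (Algebra.adjoin k (Set.range b)) a := by
    intro a
    have ha : a ∈ Algebra.adjoin k G := hG ▸ Algebra.mem_top
    have : Algebra.adjoin k G ≤
      (integralClosure (Algebra.adjoin k (Set.range b)) A).restrictScalars k :=
      Algebra.adjoin_le hint
    exact this ha
  have : Algebra.IsIntegral (Algebra.adjoin k (Set.range b)) A := ⟨hall⟩
  have h1 := Algebra.IsAlgebraic.trdeg_le_cardinalMk k (Set.range b)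
  have h2 := hind.cardinalMk_le_trdeg
  have h3 : Cardinal.mk (Set.range b) ≤ 4 := by
    have := Cardinal.mk_range_le (f := b)
    simpa using this
  have h4 := (h2.trans h1).trans h3
  rw [Cardinal.mk_fin] at h4
  have : m ≤ 4 := by exact_mod_cast h4
  omega

theorem aux_comp_mem {N : ℕ} {I : Ideal (MvPolynomial (Fin N) k)}
    (h : ∃ S : Set (MvPolynomial (Fin N) k), I = Ideal.span S ∧
      ∀ g ∈ S, ∃ d, g.IsHomogeneous d) {f : MvPolynomial (Fin N) k} (hf : f ∈ I) (n : ℕ) :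
    homogeneousComponent n f ∈ I := by
  obtain ⟨S, rfl, hS⟩ := h
  let := MvPolynomial.gradedAlgebra (σ := Fin N) (R := k)
  refine homogeneousComponent_mem_of_mem ?_ hf n
  apply Ideal.homogeneous_span
  intro g hg
  exact hS g hg

/-- The `k[ε]`-point `v + ε t`. -/
noncomputable def dualPt {N : ℕ} (v t : Fin N → k) :
    MvPolynomial (Fin N) k →ₐ[k] TrivSqZeroExt k k :=
  aeval (fun i => TrivSqZeroExt.inl (v i) + TrivSqZeroExt.inr (t i))

theorem fst_dualPt {N : ℕ} (v t : Fin N → k) (f : MvPolynomial (Fin N) k) :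
    (dualPt v t f).fst = eval v f := by
  have : (TrivSqZeroExt.fstHom k k k).comp (dualPt v t) = aeval v := by
    ext i
    simp [dualPt]
  have := congrArg (fun g => g f) this
  simpa [aeval_eq_eval] using this

theorem snd_dualPt {N : ℕ} (v t : Fin N → k) (f : MvPolynomial (Fin N) k) :
    (dualPt v t f).snd = ∑ i, eval v (pderiv i f) * t i := by
  induction f using MvPolynomial.induction_on with
  | C a => simp [dualPt, TrivSqZeroExt.algebraMap_eq_inl]
  | add f g hf hg => simp [hf, hg, add_mul, Finset.sum_add_distrib]
  | mul_X f j hf =>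
    have h1 : (dualPt v t (X j)).snd = t j := by simp [dualPt]
    have h2 : (dualPt v t (X j)).fst = v j := by simp [dualPt]
    rw [map_mul, TrivSqZeroExt.snd_mul, hf, fst_dualPt, h1, h2]
    simp only [Derivation.leibniz, pderiv_X, smul_eq_mul, MulOpposite.smul_eq_mul_unop,
      MulOpposite.unop_op, map_add, map_mul, eval_X, add_mul, Finset.sum_add_distrib,
      Finset.sum_mul]
    congr 1
    · rw [Finset.sum_eq_single j]
      · simp
      · intro i _ hij
        simp [hij.symm]
      · simp
    · apply Finset.sum_congr rfl
      intros
      ring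

theorem mem_tangentSpace {N : ℕ} (I : Ideal (MvPolynomial (Fin N) k)) (v t : Fin N → k) :
    t ∈ tangentSpace I v ↔ ∀ f ∈ I, ∑ i, eval v (pderiv i f) * t i = 0 := by
  simp [tangentSpace, Submodule.mem_iInf]

theorem dualPt_eq_zero {N : ℕ} (v t : Fin N → k) (f : MvPolynomial (Fin N) k) :
    dualPt v t f = 0 ↔ eval v f = 0 ∧ ∑ i, eval v (pderiv i f) * t i = 0 := by
  rw [TrivSqZeroExt.ext_iff, fst_dualPt, snd_dualPt]; simp

theorem mem_tangentSpace_iff {N : ℕ} (I : Ideal (MvPolynomial (Fin N) k)) (v t : Fin N → k)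
    (hv : v ∈ projZeros I) :
    t ∈ tangentSpace I v ↔ ∀ f ∈ I, dualPt v t f = 0 := by
  rw [mem_tangentSpace]
  constructor
  · intro h f hf
    exact (dualPt_eq_zero v t f).2 ⟨hv f hf, h f hf⟩
  · intro h f hf
    exact ((dualPt_eq_zero v t f).1 (h f hf)).2


theorem aux_aeval_scale {N e : ℕ} {A : Type*} [CommRing A] [Algebra k A]
    {f : MvPolynomial (Fin N) k} (hf : f.IsHomogeneous e) (r : A) (x : Fin N → A) :
    aeval (fun i => r * x i) f = r ^ e * aeval x f := by
  conv_lhs => rw [f.as_sum]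
  conv_rhs => rw [f.as_sum]
  rw [map_sum, map_sum, Finset.mul_sum]
  apply Finset.sum_congr rfl
  intro m hm
  have hd : m.degree = e := by
    by_contra h
    exact (mem_support_iff.1 hm) (hf.coeff_eq_zero h)
  rw [aeval_monomial, aeval_monomial]
  have : (m.prod fun i n => (r * x i) ^ n) = r ^ e * m.prod fun i n => x i ^ n := by
    simp only [Finsupp.prod, mul_pow, Finset.prod_mul_distrib]
    rw [Finset.prod_pow_eq_pow_sum, ← hd]
    rfl
  rw [this]; ring

theorem aux_kill {N : ℕ} {I : Ideal (MvPolynomial (Fin N) k)}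
    (h : ∃ S : Set (MvPolynomial (Fin N) k), I = Ideal.span S ∧
      ∀ g ∈ S, ∃ d, g.IsHomogeneous d) {A : Type*} [CommRing A] [Algebra k A]
    (θ : MvPolynomial (Fin N) k →ₐ[k] A)
    (hθ : ∀ e f, f ∈ I → f.IsHomogeneous e → θ f = 0) : ∀ f ∈ I, θ f = 0 := by
  intro f hf
  rw [← sum_homogeneousComponent f, map_sum]
  apply Finset.sum_eq_zero
  intro i _
  exact hθ i _ (aux_comp_mem h hf i) (homogeneousComponent_isHomogeneous i f)

theorem aux_comp_bind {N M : ℕ} (φ : Fin M → MvPolynomial (Fin N) k)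
    (hφ : ∀ i, (φ i).IsHomogeneous 1) (n : ℕ) (f : MvPolynomial (Fin M) k) :
    homogeneousComponent n (bind₁ φ f) = bind₁ φ (homogeneousComponent n f) := by
  conv_lhs => rw [← sum_homogeneousComponent f, map_sum, map_sum]
  have h : ∀ i, homogeneousComponent n (bind₁ φ (homogeneousComponent i f)) =
      if i = n then bind₁ φ (homogeneousComponent n f) else 0 := by
    intro i
    have h1 : (bind₁ φ (homogeneousComponent i f)).IsHomogeneous i := by
      have := (homogeneousComponent_isHomogeneous i f).aeval φ hφ
      rwa [one_mul] at this
    rw [homogeneousComponent_of_mem ((mem_homogeneousSubmodule _ _).2 h1)]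
    split_ifs with h2 h3 h3
    · subst h2; rfl
    · exact absurd h2.symm h3
    · exact absurd h3.symm h2
    · rfl
  rw [Finset.sum_congr rfl (fun i _ => h i), Finset.sum_ite_eq']
  split_ifs with h1
  · rfl
  · rw [homogeneousComponent_eq_zero, map_zero]
    simpa using h1

theorem aux_comp_mul_X {N : ℕ} (n : ℕ) (f : MvPolynomial (Fin N) k) (j : Fin N) :
    homogeneousComponent (n + 1) (f * X j) = homogeneousComponent n f * X j := by
  conv_lhs => rw [← sum_homogeneousComponent f, Finset.sum_mul, map_sum]
  have h : ∀ i, homogeneousComponent (n + 1) (homogeneousComponent i f * X j) =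
      if i = n then homogeneousComponent n f * X j else 0 := by
    intro i
    have h1 : (homogeneousComponent i f * X j).IsHomogeneous (i + 1) :=
      (homogeneousComponent_isHomogeneous i f).mul (isHomogeneous_X k j)
    rw [homogeneousComponent_of_mem ((mem_homogeneousSubmodule _ _).2 h1)]
    split_ifs with h2 h3 h3
    · subst h3; rfl
    · omega
    · omega
    · rfl
  rw [Finset.sum_congr rfl (fun i _ => h i), Finset.sum_ite_eq']
  split_ifs with h1
  · rfl
  · rw [homogeneousComponent_eq_zero, zero_mul]
    simpa using h1

/-- A linear embedding of `V(I)` with image `V(J)`, with a rational inverse. -/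
def LinEmb {N M : ℕ} (I : Ideal (MvPolynomial (Fin N) k)) (J : Ideal (MvPolynomial (Fin M) k)) :
    Prop :=
  ∃ (φ : Fin M → MvPolynomial (Fin N) k) (d : ℕ) (s : MvPolynomial (Fin M) k)
    (c : Fin N → MvPolynomial (Fin M) k),
    (∀ i, (φ i).IsHomogeneous 1) ∧ (∀ g, g ∈ J ↔ bind₁ φ g ∈ I) ∧ s.IsHomogeneous d ∧
    (∀ j, (c j).IsHomogeneous (d + 1)) ∧ s ∉ J ∧
    ∀ j, bind₁ φ s * X j - bind₁ φ (c j) ∈ I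

theorem aux_quot_bind {N M : ℕ} (I : Ideal (MvPolynomial (Fin N) k))
    (φ : Fin M → MvPolynomial (Fin N) k) (g : MvPolynomial (Fin M) k) :
    Ideal.Quotient.mkₐ k I (bind₁ φ g) = aeval (fun i => Ideal.Quotient.mkₐ k I (φ i)) g := by
  have : (Ideal.Quotient.mkₐ k I).comp (bind₁ φ) =
      aeval (fun i => Ideal.Quotient.mkₐ k I (φ i)) := by
    ext i; simp
  rw [← this]; rfl

theorem aux_mem_iff {N : ℕ} (I : Ideal (MvPolynomial (Fin N) k)) (f : MvPolynomial (Fin N) k) :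
    f ∈ I ↔ Ideal.Quotient.mkₐ k I f = 0 := by
  simp [Ideal.Quotient.eq_zero_iff_mem]

theorem aux_aeval_mk {N : ℕ} (I : Ideal (MvPolynomial (Fin N) k)) (f : MvPolynomial (Fin N) k) :
    aeval (fun i => Ideal.Quotient.mkₐ k I (X i)) f = Ideal.Quotient.mkₐ k I f := by
  have := aux_quot_bind I X f
  simpa using this.symm

/-- Key computation: pulling back along `φ` the substitution `x ↦ c` multiplies by `s ^ e`. -/
theorem aux_bind_c {N M : ℕ} {I : Ideal (MvPolynomial (Fin N) k)}
    {φ : Fin M → MvPolynomial (Fin N) k} {s : MvPolynomial (Fin M) k}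
    {c : Fin N → MvPolynomial (Fin M) k}
    (h : ∀ j, bind₁ φ s * X j - bind₁ φ (c j) ∈ I) {e : ℕ} {f : MvPolynomial (Fin N) k}
    (hf : f.IsHomogeneous e) :
    bind₁ φ (bind₁ c f) - bind₁ φ s ^ e * f ∈ I := by
  rw [aux_mem_iff, map_sub, sub_eq_zero, bind₁_bind₁, aux_quot_bind, map_mul, map_pow,
    ← aux_aeval_mk I f, ← aux_aeval_scale hf]
  congr 2
  funext j
  have := h j
  rw [aux_mem_iff, map_sub, sub_eq_zero, map_mul] at this
  exact this.symm

theorem aux_bind_c_mem {N M : ℕ} {I : Ideal (MvPolynomial (Fin N) k)}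
    {J : Ideal (MvPolynomial (Fin M) k)}
    (hI : ∃ S : Set (MvPolynomial (Fin N) k), I = Ideal.span S ∧
      ∀ g ∈ S, ∃ d, g.IsHomogeneous d)
    {φ : Fin M → MvPolynomial (Fin N) k} {s : MvPolynomial (Fin M) k}
    {c : Fin N → MvPolynomial (Fin M) k} (hJ : ∀ g, g ∈ J ↔ bind₁ φ g ∈ I)
    (h : ∀ j, bind₁ φ s * X j - bind₁ φ (c j) ∈ I) :
    ∀ f ∈ I, bind₁ c f ∈ J := by
  intro f hf
  rw [aux_mem_iff]
  refine aux_kill hI ((Ideal.Quotient.mkₐ k J).comp (bind₁ c)) ?_ f hf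
  intro e f hf hfe
  rw [AlgHom.comp_apply, ← aux_mem_iff, hJ]
  have := aux_bind_c h hfe
  have h2 := I.mul_mem_left (bind₁ φ s ^ e) hf
  simpa using I.add_mem this h2

theorem aux_bind_phi {N M : ℕ} {I : Ideal (MvPolynomial (Fin N) k)}
    {J : Ideal (MvPolynomial (Fin M) k)}
    {φ : Fin M → MvPolynomial (Fin N) k} {s : MvPolynomial (Fin M) k}
    {c : Fin N → MvPolynomial (Fin M) k} (hφ : ∀ i, (φ i).IsHomogeneous 1)
    (hJ : ∀ g, g ∈ J ↔ bind₁ φ g ∈ I)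
    (h : ∀ j, bind₁ φ s * X j - bind₁ φ (c j) ∈ I) (i : Fin M) :
    bind₁ c (φ i) - s * X i ∈ J := by
  rw [hJ]
  have := aux_bind_c h (hφ i)
  simpa using this

theorem LinEmb.birEquiv {N M : ℕ} {I : Ideal (MvPolynomial (Fin N) k)}
    {J : Ideal (MvPolynomial (Fin M) k)}
    (hI : ∃ S : Set (MvPolynomial (Fin N) k), I = Ideal.span S ∧
      ∀ g ∈ S, ∃ d, g.IsHomogeneous d) (h : LinEmb I J) : IdealBirEquiv I J := by
  obtain ⟨φ, d, s, c, hφ, hJ, hs, hc, hsJ, hrel⟩ := h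
  refine ⟨φ, c, ⟨1, hφ⟩, ⟨d + 1, hc⟩, fun g hg => (hJ g).1 hg,
    aux_bind_c_mem hI hJ hrel, ⟨bind₁ φ s, fun h => hsJ ((hJ s).2 h), ?_⟩,
    ⟨s, hsJ, aux_bind_phi hφ hJ hrel⟩⟩
  intro j
  have := I.neg_mem (hrel j)
  simpa using this

theorem LinEmb.trans {N M L : ℕ} {I : Ideal (MvPolynomial (Fin N) k)}
    {J : Ideal (MvPolynomial (Fin M) k)} {K : Ideal (MvPolynomial (Fin L) k)}
    (hJp : J.IsPrime) (h1 : LinEmb I J) (h2 : LinEmb J K) : LinEmb I K := by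
  obtain ⟨φ, d, s, c, hφ, hJ, hs, hc, hsJ, hrel⟩ := h1
  obtain ⟨φ', d', s', c', hφ', hK, hs', hc', hsK, hrel'⟩ := h2
  have hs'J : bind₁ φ' s' ∉ J := fun h => hsK ((hK _).2 h)
  have e1 := aux_bind_c hrel' hs
  refine ⟨fun i => bind₁ φ (φ' i), d' + (d' + 1) * d, s' * bind₁ c' s,
    fun j => bind₁ c' (c j), ?_, ?_, hs'.mul (hs.aeval _ hc'), ?_, ?_, ?_⟩
  · intro i
    have := (hφ' i).aeval φ hφ
    rwa [one_mul] at this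
  · intro g
    rw [hK, hJ, bind₁_bind₁]
  · intro j
    have := (hc j).aeval c' hc'
    convert! this using 1
    ring
  · rw [hK, map_mul]
    intro hmem
    rcases hJp.mem_or_mem hmem with h | h
    · exact hs'J h
    · have h3 := J.sub_mem h e1
      rw [sub_sub_cancel] at h3
      rcases hJp.mem_or_mem h3 with h | h
      · exact hs'J (hJp.mem_of_pow_mem _ h)
      · exact hsJ h
  · intro j
    have e2 := aux_bind_c hrel' (hc j)
    rw [← bind₁_bind₁, ← bind₁_bind₁]
    have f1 := (hJ _).1 e1
    have f2 := (hJ _).1 e2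
    have f3 := hrel j
    rw [aux_mem_iff] at *
    simp only [map_sub, map_mul, map_pow] at *
    rw [sub_eq_zero] at *
    rw [f1, f2, ← f3]
    ring


/-- The linear forms given by the rows of a matrix. -/
noncomputable def linForm {N M : ℕ} (a : Matrix (Fin M) (Fin N) k) (i : Fin M) :
    MvPolynomial (Fin N) k := ∑ j, C (a i j) * X j

theorem linForm_homog {N M : ℕ} (a : Matrix (Fin M) (Fin N) k) (i : Fin M) :
    (linForm a i).IsHomogeneous 1 :=
  IsHomogeneous.sum _ _ _ fun _ _ => isHomogeneous_C_mul_X _ _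

theorem eval_linForm {N M : ℕ} (a : Matrix (Fin M) (Fin N) k) (v : Fin N → k) (i : Fin M) :
    eval v (linForm a i) = (a.mulVec v) i := by
  simp [linForm, Matrix.mulVec, dotProduct]

theorem eval_bind_linForm {N M : ℕ} (a : Matrix (Fin M) (Fin N) k) (v : Fin N → k)
    (g : MvPolynomial (Fin M) k) :
    eval v (bind₁ (linForm a) g) = eval (a.mulVec v) g := by
  have : (aeval v : MvPolynomial (Fin N) k →ₐ[k] k).comp (bind₁ (linForm a)) =
      aeval (a.mulVec v) := by
    ext i
    simp only [AlgHom.comp_apply, bind₁_X_right, aeval_X]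
    rw [← eval_linForm, aeval_eq_eval]
  have := congrArg (fun h => h g) this
  simpa [aeval_eq_eval] using this

theorem dualPt_bind_linForm {N M : ℕ} (a : Matrix (Fin M) (Fin N) k) (v t : Fin N → k)
    (g : MvPolynomial (Fin M) k) :
    dualPt v t (bind₁ (linForm a) g) = dualPt (a.mulVec v) (a.mulVec t) g := by
  have : (dualPt v t).comp (bind₁ (linForm a)) = dualPt (a.mulVec v) (a.mulVec t) := by
    ext i
    · simp [dualPt, linForm, Matrix.mulVec, dotProduct, TrivSqZeroExt.algebraMap_eq_inl,
        TrivSqZeroExt.fst_sum, TrivSqZeroExt.snd_sum]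
    · simp [dualPt, linForm, Matrix.mulVec, dotProduct, TrivSqZeroExt.algebraMap_eq_inl,
        TrivSqZeroExt.fst_sum, TrivSqZeroExt.snd_sum]
  have := congrArg (fun h => h g) this
  simpa using this

theorem aux_exists_pt [IsAlgClosed k] {M : ℕ} {J : Ideal (MvPolynomial (Fin M) k)}
    (hp : J.IsPrime) (hdim : ringKrullDim (MvPolynomial (Fin M) k ⧸ J) = 2) :
    ∃ q ∈ projZeros J, q ≠ 0 := by
  by_contra hcon
  push Not at hcon
  have hX : ∀ i, (X i : MvPolynomial (Fin M) k) ∈ J := by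
    intro i
    rw [← hp.radical, ← vanishingIdeal_zeroLocus_eq_radical (K := k) J, mem_vanishingIdeal_iff]
    intro x hx
    have hx0 : x = 0 := hcon x (by
      intro f hf
      have := (mem_zeroLocus_iff.1 hx) f hf
      simpa [aeval_eq_eval] using this)
    simp [hx0]
  have hsurj : Function.Surjective ((Ideal.Quotient.mk J).comp (C : k →+* _)) := by
    intro y
    obtain ⟨f, rfl⟩ := Ideal.Quotient.mk_surjective y
    induction f using MvPolynomial.induction_on with
    | C a => exact ⟨a, rfl⟩
    | add f g hf hg =>
      obtain ⟨a, ha⟩ := hf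
      obtain ⟨b, hb⟩ := hg
      exact ⟨a + b, by rw [map_add, ha, hb, map_add]⟩
    | mul_X f i _ =>
      refine ⟨0, ?_⟩
      rw [map_zero, map_mul, Ideal.Quotient.eq_zero_iff_mem.2 (hX i), mul_zero]
  have h := ringKrullDim_le_of_surjective _ hsurj
  rw [hdim, ringKrullDim_eq_zero_of_field] at h
  exact absurd h (by decide)

/-- Extending an `A`-valued point of `V(J)` to one of `V(I)`. -/
theorem aux_lift_pt {N M : ℕ} {I : Ideal (MvPolynomial (Fin N) k)}
    {J : Ideal (MvPolynomial (Fin M) k)}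
    (hI : ∃ S : Set (MvPolynomial (Fin N) k), I = Ideal.span S ∧
      ∀ g ∈ S, ∃ d, g.IsHomogeneous d)
    {φ : Fin M → MvPolynomial (Fin N) k} {s : MvPolynomial (Fin M) k}
    {c : Fin N → MvPolynomial (Fin M) k} (hφ : ∀ i, (φ i).IsHomogeneous 1)
    (hJ : ∀ g, g ∈ J ↔ bind₁ φ g ∈ I)
    (h : ∀ j, bind₁ φ s * X j - bind₁ φ (c j) ∈ I)
    {A : Type*} [CommRing A] [Algebra k A] (θ : MvPolynomial (Fin M) k →ₐ[k] A)
    (hθ : ∀ g ∈ J, θ g = 0) (u : A) (hu : u * θ s = 1) :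
    (∀ f ∈ I, aeval (fun j => u * θ (c j)) f = 0) ∧
      ∀ i, aeval (fun j => u * θ (c j)) (φ i) = θ (X i) := by
  have hcomp : ∀ f, aeval (fun j => θ (c j)) f = θ (bind₁ c f) := by
    intro f
    have : θ.comp (bind₁ c) = aeval (fun j => θ (c j)) := by ext; simp
    rw [← this]; rfl
  constructor
  · refine aux_kill hI _ ?_
    intro e f hf hfe
    rw [aux_aeval_scale hfe, hcomp, hθ _ (aux_bind_c_mem hI hJ h f hf), mul_zero]
  · intro i
    rw [aux_aeval_scale (hφ i), hcomp]
    have := hθ _ (aux_bind_phi hφ hJ h i)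
    rw [map_sub, sub_eq_zero, map_mul] at this
    rw [this, pow_one, ← mul_assoc, hu, one_mul]

theorem aux_emb [IsAlgClosed k] {N M : ℕ} {I : Ideal (MvPolynomial (Fin N) k)}
    (hI : IsProjCurveIdeal I) (hsm : IsSmoothCurve I) (a : Matrix (Fin M) (Fin N) k)
    (hint : ((Ideal.Quotient.mk I).comp (bind₁ (linForm a)).toRingHom).IsIntegral)
    (hpt : ∀ q, (∀ g, bind₁ (linForm a) g ∈ I → eval q g = 0) → q ≠ 0 →
      ∃ (s : MvPolynomial (Fin M) k) (c : Fin N → MvPolynomial (Fin M) k),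
        eval q s ≠ 0 ∧ ∀ j, bind₁ (linForm a) s * X j - bind₁ (linForm a) (c j) ∈ I) :
    ∃ J : Ideal (MvPolynomial (Fin M) k), IsProjCurveIdeal J ∧ IsSmoothCurve J ∧ LinEmb I J := by
  have hIp := hI.prime
  set φ := linForm a with hφdef
  have hφ : ∀ i, (φ i).IsHomogeneous 1 := linForm_homog a
  let J : Ideal (MvPolynomial (Fin M) k) := I.comap (bind₁ φ).toRingHom
  have hJ : ∀ g, g ∈ J ↔ bind₁ φ g ∈ I := fun g => Iff.rfl
  have hJp : J.IsPrime := Ideal.IsPrime.comap _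
  have hJdim : ringKrullDim (MvPolynomial (Fin M) k ⧸ J) = 2 := by
    rw [← hI.dim]
    refine aux_krullDim_integral (Ideal.quotientMap I (bind₁ φ).toRingHom le_rfl)
      (Ideal.quotientMap_injective) ?_
    refine RingHom.IsIntegral.tower_top (Ideal.Quotient.mk J) _ ?_
    rw [Ideal.quotientMap_comp_mk]
    exact hint
  have hJhom : ∃ S : Set (MvPolynomial (Fin M) k), J = Ideal.span S ∧
      ∀ g ∈ S, ∃ d, g.IsHomogeneous d := by
    refine ⟨{g | g ∈ J ∧ ∃ d, g.IsHomogeneous d}, ?_, fun g hg => hg.2⟩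
    apply le_antisymm
    · intro g hg
      rw [← sum_homogeneousComponent g]
      apply Ideal.sum_mem
      intro i _
      refine Ideal.subset_span ⟨?_, i, homogeneousComponent_isHomogeneous i g⟩
      rw [hJ, ← aux_comp_bind φ hφ]
      exact aux_comp_mem hI.homog ((hJ g).1 hg) i
    · rw [Ideal.span_le]
      exact fun g hg => hg.1
  -- homogeneous local inverses
  have hpt' : ∀ q ∈ projZeros J, q ≠ 0 →
      ∃ (d : ℕ) (s : MvPolynomial (Fin M) k) (c : Fin N → MvPolynomial (Fin M) k),
        s.IsHomogeneous d ∧ (∀ j, (c j).IsHomogeneous (d + 1)) ∧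
        eval q s ≠ 0 ∧ ∀ j, bind₁ φ s * X j - bind₁ φ (c j) ∈ I := by
    intro q hq hq0
    obtain ⟨s, c, hs, hrel⟩ := hpt q hq hq0
    have : ∃ d, eval q (homogeneousComponent d s) ≠ 0 := by
      by_contra hc
      push Not at hc
      apply hs
      rw [← sum_homogeneousComponent s, map_sum]
      exact Finset.sum_eq_zero fun i _ => hc i
    obtain ⟨d, hd⟩ := this
    refine ⟨d, homogeneousComponent d s, fun j => homogeneousComponent (d + 1) (c j),
      homogeneousComponent_isHomogeneous _ _, fun j => homogeneousComponent_isHomogeneous _ _,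
      hd, fun j => ?_⟩
    have := aux_comp_mem hI.homog (hrel j) (d + 1)
    rw [map_sub, aux_comp_mul_X, aux_comp_bind φ hφ, aux_comp_bind φ hφ] at this
    exact this
  refine ⟨J, ⟨hJp, hJhom, hJdim⟩, ?_, ?_⟩
  · intro q hq hq0
    obtain ⟨d, s, c, hs, hc, hsq, hrel⟩ := hpt' q hq hq0
    -- the point above
    set v : Fin N → k := fun j => (eval q s)⁻¹ * eval q (c j) with hv
    have hlift := aux_lift_pt hI.homog hφ hJ hrel (aeval q : MvPolynomial (Fin M) k →ₐ[k] k)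
      (fun g hg => by simpa [aeval_eq_eval] using hq g hg) (eval q s)⁻¹
      (by simpa [aeval_eq_eval] using inv_mul_cancel₀ hsq)
    have hvI : v ∈ projZeros I := by
      intro f hf
      have := hlift.1 f hf
      simpa [aeval_eq_eval, hv] using this
    have hav : a.mulVec v = q := by
      funext i
      have := hlift.2 i
      rw [← eval_linForm]
      simpa [aeval_eq_eval, hv] using this
    have hv0 : v ≠ 0 := by
      intro h
      apply hq0
      rw [← hav, h, Matrix.mulVec_zero]
    rw [← hsm v hvI hv0]
    have hmaps : ∀ t ∈ tangentSpace I v, a.mulVecLin t ∈ tangentSpace J q := by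
      intro t ht
      rw [mem_tangentSpace_iff I v t hvI] at ht
      rw [mem_tangentSpace_iff J q _ hq]
      intro g hg
      have := ht _ ((hJ g).1 hg)
      rw [dualPt_bind_linForm, hav] at this
      exact this
    let Φ : tangentSpace I v →ₗ[k] tangentSpace J q := a.mulVecLin.restrict hmaps
    symm
    apply LinearEquiv.finrank_eq
    refine LinearEquiv.ofBijective Φ ⟨?_, ?_⟩
    · rw [injective_iff_map_eq_zero]
      rintro ⟨t, ht⟩ h0
      have h0' : a.mulVec t = 0 := congrArg Subtype.val h0
      rw [mem_tangentSpace_iff I v t hvI] at ht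
      ext j
      have h1 := ht _ (hrel j)
      rw [map_sub, map_mul, dualPt_bind_linForm, dualPt_bind_linForm, hav, h0'] at h1
      have h2 := congrArg TrivSqZeroExt.snd h1
      have h3 : (dualPt v t (X j)).snd = t j := by simp [dualPt]
      rw [TrivSqZeroExt.snd_sub, TrivSqZeroExt.snd_mul, h3, fst_dualPt,
        snd_dualPt, snd_dualPt] at h2
      simp only [Pi.zero_apply, mul_zero, Finset.sum_const_zero, smul_zero, add_zero, sub_zero,
        TrivSqZeroExt.snd_zero, smul_eq_mul] at h2
      simpa using (mul_eq_zero.1 h2).resolve_left hsq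
    · rintro ⟨t', ht'⟩
      rw [mem_tangentSpace_iff J q _ hq] at ht'
      have hfs : (dualPt q t' s).fst ≠ 0 := by rwa [fst_dualPt]
      have hu : ∃ u : TrivSqZeroExt k k, u * dualPt q t' s = 1 := by
        have : IsUnit (dualPt q t' s) := by
          rw [TrivSqZeroExt.isUnit_iff_isUnit_fst]
          exact hfs.isUnit
        exact this.exists_left_inv
      obtain ⟨u, hu⟩ := hu
      obtain ⟨l1, l2⟩ := aux_lift_pt hI.homog hφ hJ hrel (dualPt q t') ht' u hu
      let t : Fin N → k := fun j => (u * dualPt q t' (c j)).snd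
      have hufst : u.fst = (eval q s)⁻¹ := by
        have := congrArg TrivSqZeroExt.fst hu
        rw [TrivSqZeroExt.fst_mul, fst_dualPt, TrivSqZeroExt.fst_one] at this
        exact eq_inv_of_mul_eq_one_left this
      have hpteq : aeval (fun j => u * dualPt q t' (c j)) = dualPt v t := by
        unfold dualPt
        congr 1
        funext j
        have hfst : (u * dualPt q t' (c j)).fst = v j := by
          rw [TrivSqZeroExt.fst_mul, fst_dualPt, hufst]
        rw [← hfst]
        exact (TrivSqZeroExt.inl_fst_add_inr_snd_eq _).symm
      rw [hpteq] at l1 l2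
      refine ⟨⟨t, (mem_tangentSpace_iff I v t hvI).2 l1⟩, ?_⟩
      ext i
      have h1 := l2 i
      have h2 := dualPt_bind_linForm a v t (X i)
      rw [bind₁_X_right] at h2
      rw [← hφdef, h1] at h2
      have h3 := congrArg TrivSqZeroExt.snd h2
      simp only [dualPt, aeval_X, TrivSqZeroExt.snd_add, TrivSqZeroExt.snd_inl,
        TrivSqZeroExt.snd_inr, zero_add] at h3
      exact h3.symm
  · obtain ⟨q, hq, hq0⟩ := aux_exists_pt hJp hJdim
    obtain ⟨d, s, c, hs, hc, hsq, hrel⟩ := hpt' q hq hq0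
    exact ⟨φ, d, s, c, hφ, hJ, hs, hc, fun h => hsq (hq s h), hrel⟩


/-- Padding with zero coordinates. -/
theorem aux_pad [IsAlgClosed k] {N : ℕ} (hN : N ≤ 4) {I : Ideal (MvPolynomial (Fin N) k)}
    (hI : IsProjCurveIdeal I) (hsm : IsSmoothCurve I) :
    ∃ J : Ideal (MvPolynomial (Fin 4) k), IsProjCurveIdeal J ∧ IsSmoothCurve J ∧ LinEmb I J := by
  let a : Matrix (Fin 4) (Fin N) k := fun i j => if i = Fin.castLE hN j then 1 else 0
  have hlin : ∀ j, linForm a (Fin.castLE hN j) = X j := by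
    intro j
    simp only [linForm, a]
    rw [Finset.sum_eq_single j]
    · simp
    · intro b _ hb
      rw [if_neg, C_0, zero_mul]
      intro h
      exact hb ((Fin.castLE_injective hN h).symm)
    · simp
  have hc : ∀ f, bind₁ (linForm a) (rename (Fin.castLE hN) f) = f := by
    intro f
    rw [bind₁_rename]
    have : (linForm a) ∘ (Fin.castLE hN) = X := funext hlin
    rw [this, bind₁_X_left]
    rfl
  refine aux_emb hI hsm a ?_ ?_
  · apply RingHom.IsIntegral.of_finite
    apply RingHom.Finite.of_surjective
    intro y
    obtain ⟨f, rfl⟩ := Ideal.Quotient.mk_surjective y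
    exact ⟨rename (Fin.castLE hN) f, congrArg _ (hc f)⟩
  · intro q _ _
    refine ⟨1, fun j => rename (Fin.castLE hN) (X j), by simp, fun j => ?_⟩
    rw [hc]
    simp


theorem aux_int_map {S D : Type} [CommRing S] [CommRing D] [Algebra k S] [Algebra k D]
    (θ : S →ₐ[k] D) (b : Set S) (B : Set D) (hB : ∀ x ∈ b, θ x ∈ Algebra.adjoin k B) (x : S)
    (h : IsIntegral (Algebra.adjoin k b) x) : IsIntegral (Algebra.adjoin k B) (θ x) := by
  obtain ⟨p, hp, hpx⟩ := h
  have hmem : ∀ y : Algebra.adjoin k b, θ y ∈ Algebra.adjoin k B := by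
    rintro ⟨y, hy⟩
    have h1 : Algebra.adjoin k b ≤ (Algebra.adjoin k B).comap θ :=
      Algebra.adjoin_le hB
    exact h1 hy
  let g : Algebra.adjoin k b →ₐ[k] Algebra.adjoin k B :=
    (θ.comp (Algebra.adjoin k b).val).codRestrict _ hmem
  refine ⟨p.map g.toRingHom, hp.map _, ?_⟩
  rw [Polynomial.eval₂_map]
  have := congrArg θ hpx
  rw [map_zero] at this
  rw [← this]
  exact (Polynomial.hom_eval₂ p (algebraMap (Algebra.adjoin k b) S) θ.toRingHom x).symm

theorem aux_noether {N : ℕ} {I : Ideal (MvPolynomial (Fin N) k)} (hI : IsProjCurveIdeal I) :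
    ∃ b : Fin 2 → MvPolynomial (Fin N) k ⧸ I,
      ∀ x : MvPolynomial (Fin N) k ⧸ I, IsIntegral (Algebra.adjoin k (Set.range b)) x := by
  have hIp := hI.prime
  obtain ⟨s, g, hg, hgi⟩ := exists_integral_inj_algHom_of_fg k (MvPolynomial (Fin N) k ⧸ I)
  have hd := aux_krullDim_integral g.toRingHom hg hgi
  rw [hI.dim, MvPolynomial.ringKrullDim_of_isNoetherianRing,
    ringKrullDim_eq_zero_of_field, zero_add] at hd
  have hs : s = 2 := by
    rw [Nat.card_fin] at hd
    exact_mod_cast hd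
  subst hs
  refine ⟨fun i => g (X i), fun x => ?_⟩
  obtain ⟨p, hp, hpx⟩ := hgi x
  have hmem : ∀ y, g y ∈ Algebra.adjoin k (Set.range fun i => g (X i)) := by
    intro y
    rw [Algebra.adjoin_range_eq_range_aeval]
    refine ⟨y, ?_⟩
    have : aeval (fun i => g (X i)) = g := by ext; simp
    change aeval (fun i => g (X i)) y = g y
    rw [this]
  let g' := g.codRestrict _ hmem
  refine ⟨p.map g'.toRingHom, hp.map _, ?_⟩
  rw [Polynomial.eval₂_map]
  exact hpx

theorem aux_adjoin_top {σ A : Type} [CommRing A] [Algebra k A] (ψ : MvPolynomial σ k →ₐ[k] A)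
    (hψ : Function.Surjective ψ) : Algebra.adjoin k (Set.range fun i => ψ (X i)) = ⊤ := by
  rw [Algebra.adjoin_range_eq_range_aeval, eq_top_iff]
  rintro y -
  obtain ⟨y, rfl⟩ := hψ y
  refine ⟨y, ?_⟩
  have : aeval (fun i => ψ (X i)) = ψ := by ext; simp
  change aeval (fun i => ψ (X i)) y = ψ y
  rw [this]

/-- A nonzero polynomial vanishing on all differences of points of the cone. -/
theorem aux_secant {n : ℕ} (hn : 5 ≤ n) {I : Ideal (MvPolynomial (Fin n) k)}
    (hI : IsProjCurveIdeal I) :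
    ∃ F : MvPolynomial (Fin n) k, F ≠ 0 ∧ ∀ v ∈ projZeros I, ∀ w ∈ projZeros I,
      eval (fun i => v i - w i) F = 0 := by
  obtain ⟨b, hb⟩ := aux_noether hI
  let Q : Ideal (MvPolynomial (Fin n ⊕ Fin n) k) := I.map (rename Sum.inl : _ →ₐ[k] MvPolynomial (Fin n ⊕ Fin n) k) ⊔ I.map (rename Sum.inr : _ →ₐ[k] MvPolynomial (Fin n ⊕ Fin n) k)
  have key : ∀ P ∈ Q.minimalPrimes, ∃ F : MvPolynomial (Fin n) k, F ≠ 0 ∧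
      aeval (fun i => (X (Sum.inl i) - X (Sum.inr i) : MvPolynomial (Fin n ⊕ Fin n) k)) F ∈ P := by
    intro P hP
    have hPp : P.IsPrime := hP.1.1
    have hQP : Q ≤ P := hP.1.2
    let m := Ideal.Quotient.mkₐ k P
    let θ1 : MvPolynomial (Fin n) k ⧸ I →ₐ[k] MvPolynomial (Fin n ⊕ Fin n) k ⧸ P :=
      Ideal.Quotient.liftₐ I (m.comp (rename Sum.inl)) (by
        intro f hf
        exact Ideal.Quotient.eq_zero_iff_mem.2
          (hQP (Ideal.mem_sup_left (Ideal.mem_map_of_mem _ hf))))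
    let θ2 : MvPolynomial (Fin n) k ⧸ I →ₐ[k] MvPolynomial (Fin n ⊕ Fin n) k ⧸ P :=
      Ideal.Quotient.liftₐ I (m.comp (rename Sum.inr)) (by
        intro f hf
        exact Ideal.Quotient.eq_zero_iff_mem.2
          (hQP (Ideal.mem_sup_right (Ideal.mem_map_of_mem _ hf))))
    have h1 : ∀ f, θ1 (Ideal.Quotient.mk I f) = m (rename Sum.inl f) := fun f => rfl
    have h2 : ∀ f, θ2 (Ideal.Quotient.mk I f) = m (rename Sum.inr f) := fun f => rfl
    let b' : Fin 4 → MvPolynomial (Fin n ⊕ Fin n) k ⧸ P :=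
      Sum.elim (fun i => θ1 (b i)) (fun i => θ2 (b i)) ∘ (finSumFinEquiv (m := 2) (n := 2)).symm
    obtain ⟨F, hF, hF0⟩ := aux_dependent b' (Set.range fun i => m (X i))
      (aux_adjoin_top m (Ideal.Quotient.mkₐ_surjective k P)) (by
        rintro _ ⟨i | i, rfl⟩
        · have := aux_int_map θ1 (Set.range b) (Set.range b') (by
            rintro _ ⟨j, rfl⟩
            exact Algebra.subset_adjoin ⟨finSumFinEquiv (m := 2) (n := 2) (Sum.inl j), by
              simp only [b', Function.comp, Equiv.symm_apply_apply, Sum.elim_inl]⟩)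
            (Ideal.Quotient.mk I (X i)) (hb _)
          rw [h1, rename_X] at this
          exact this
        · have := aux_int_map θ2 (Set.range b) (Set.range b') (by
            rintro _ ⟨j, rfl⟩
            exact Algebra.subset_adjoin ⟨finSumFinEquiv (m := 2) (n := 2) (Sum.inr j), by
              simp only [b', Function.comp, Equiv.symm_apply_apply, Sum.elim_inr]⟩)
            (Ideal.Quotient.mk I (X i)) (hb _)
          rw [h2, rename_X] at this
          exact this) n hn (fun i => m (X (Sum.inl i) - X (Sum.inr i)))
    refine ⟨F, hF, ?_⟩
    rw [← Ideal.Quotient.eq_zero_iff_mem]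
    have := map_aeval (fun i => (X (Sum.inl i) - X (Sum.inr i) : MvPolynomial (Fin n ⊕ Fin n) k)) m.toRingHom F
    rw [← hF0]
    have e : m.comp (aeval fun i => (X (Sum.inl i) - X (Sum.inr i) : MvPolynomial (Fin n ⊕ Fin n) k)) =
      aeval (fun i => m (X (Sum.inl i) - X (Sum.inr i))) := by ext; simp
    rw [← e]
    rfl
  choose! F hF hFP using key
  have hfin : Q.minimalPrimes.Finite := Q.finite_minimalPrimes_of_isNoetherianRing
  refine ⟨∏ P ∈ hfin.toFinset, F P, Finset.prod_ne_zero_iff.2 fun P hP =>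
    hF P (hfin.mem_toFinset.1 hP), ?_⟩
  intro v hv w hw
  let ev : MvPolynomial (Fin n ⊕ Fin n) k →ₐ[k] k := aeval (Sum.elim v w)
  have hQ : Q ≤ RingHom.ker ev := by
    refine sup_le (Ideal.map_le_iff_le_comap.2 ?_) (Ideal.map_le_iff_le_comap.2 ?_)
    · intro f hf
      change ev (rename Sum.inl f) = 0
      simp only [ev, aeval_rename, Sum.elim_comp_inl]
      simpa [aeval_eq_eval] using hv f hf
    · intro f hf
      change ev (rename Sum.inr f) = 0
      simp only [ev, aeval_rename, Sum.elim_comp_inr]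
      simpa [aeval_eq_eval] using hw f hf
  have hkp : (RingHom.ker ev).IsPrime := RingHom.ker_isPrime _
  obtain ⟨P, hP, hPk⟩ := Ideal.exists_minimalPrimes_le hQ
  have h0 : ev (aeval (fun i => (X (Sum.inl i) - X (Sum.inr i) : MvPolynomial (Fin n ⊕ Fin n) k)) (F P)) = 0 := hPk (hFP P hP)
  have e : ev.comp (aeval fun i => (X (Sum.inl i) - X (Sum.inr i) : MvPolynomial (Fin n ⊕ Fin n) k)) =
      aeval (fun i => v i - w i) := by ext; simp [ev]
  have h1 : aeval (fun i => v i - w i) (F P) = 0 := by rw [← e]; exact h0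
  rw [aeval_eq_eval] at h1
  rw [map_prod]
  exact Finset.prod_eq_zero (hfin.mem_toFinset.2 hP) h1


theorem aux_int_mem {A : Type} [CommRing A] [Algebra k A] (B : Set A) (x : A)
    (h : x ∈ Algebra.adjoin k B) : IsIntegral (Algebra.adjoin k B) x :=
  isIntegral_algebraMap (R := Algebra.adjoin k B) (x := ⟨x, h⟩)

theorem aux_rows {n : ℕ} {I : Ideal (MvPolynomial (Fin n) k)} (v₀ : Fin n → k)
    (hT : Module.finrank k (tangentSpace I v₀) = 2) :
    ∃ (M : Matrix (Fin n) (Fin n) (MvPolynomial (Fin n) k)) (ℓ : Matrix (Fin 2) (Fin n) k)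
      (c : Matrix (Fin n) (Fin 2) k), eval v₀ M.det ≠ 0 ∧
      ∀ v t, t ∈ tangentSpace I v →
        ((eval v).mapMatrix M).mulVec t = c.mulVec (ℓ.mulVec t) := by
  obtain ⟨L, hL⟩ := LinearMap.exists_extend
    (LinearEquiv.ofFinrankEq (tangentSpace I v₀) (Fin 2 → k) (by rw [hT]; simp)).toLinearMap
  have hLinj : ∀ t ∈ tangentSpace I v₀, L t = 0 → t = 0 := by
    intro t ht h0
    have h1 := congrArg (fun g => g ⟨t, ht⟩) hL
    simp only [LinearMap.comp_apply, Submodule.subtype_apply, h0, LinearEquiv.coe_coe] at h1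
    have h2 := (LinearEquiv.map_eq_zero_iff _).1 h1.symm
    exact congrArg Subtype.val h2
  let ℓ := LinearMap.toMatrix' L
  have hℓ : ∀ t, ℓ.mulVec t = L t := fun t => LinearMap.toMatrix'_mulVec L t
  let RS : Set (Fin n → MvPolynomial (Fin n) k) :=
    {r | (∃ f ∈ I, r = fun i => pderiv i f) ∨ ∃ e, r = fun i => C (ℓ e i)}
  let ev : (Fin n → MvPolynomial (Fin n) k) → (Fin n → k) := fun r i => eval v₀ (r i)
  have hspan : Submodule.span k (ev '' RS) = ⊤ := by
    by_contra hne
    obtain ⟨f, hf0, hf⟩ := Submodule.exists_le_ker_of_lt_top _ (lt_top_iff_ne_top.2 hne)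
    let t : Fin n → k := fun i => f (fun j => if i = j then 1 else 0)
    have hft : ∀ x, f x = ∑ i, x i * t i := by
      intro x
      rw [LinearMap.pi_apply_eq_sum_univ]
      rfl
    have hz : ∀ r ∈ RS, ∑ i, ev r i * t i = 0 := by
      intro r hr
      rw [← hft]
      exact hf (Submodule.subset_span ⟨r, hr, rfl⟩)
    have ht : t ∈ tangentSpace I v₀ := by
      rw [mem_tangentSpace]
      intro g hg
      exact hz _ (Or.inl ⟨g, hg, rfl⟩)
    have ht0 : t = 0 := by
      apply hLinj t ht
      rw [← hℓ]
      funext e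
      have := hz _ (Or.inr ⟨e, rfl⟩)
      simpa [ev, Matrix.mulVec, dotProduct] using this
    apply hf0
    ext x
    simp [hft, ht0]
  obtain ⟨B, hBs, hBspan, hBli⟩ := exists_linearIndependent k (ev '' RS)
  rw [hspan] at hBspan
  let bas : Module.Basis B k (Fin n → k) := Module.Basis.mk hBli (by
    rw [Subtype.range_coe, hBspan])
  let e : Fin n ≃ B := (Pi.basisFun k (Fin n)).indexEquiv bas
  have hch : ∀ j : Fin n, ∃ r ∈ RS, ev r = (e j : Fin n → k) := fun j => hBs (e j).2
  choose ρ hρ hρe using hch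
  have hcc : ∀ j : Fin n, ∃ c : Fin 2 → k, ∀ v t, t ∈ tangentSpace I v →
      ∑ i, eval v (ρ j i) * t i = ∑ e, c e * (ℓ.mulVec t) e := by
    intro j
    rcases hρ j with ⟨f, hf, hr⟩ | ⟨e, hr⟩
    · refine ⟨0, fun v t ht => ?_⟩
      rw [mem_tangentSpace] at ht
      rw [hr, ht f hf]
      simp
    · refine ⟨Pi.single e 1, fun v t ht => ?_⟩
      rw [hr]
      simp [Pi.single_apply, Matrix.mulVec, dotProduct]
  choose c hc using hcc
  refine ⟨Matrix.of ρ, ℓ, Matrix.of c, ?_, ?_⟩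
  · rw [RingHom.map_det]
    have hu : IsUnit ((eval v₀).mapMatrix (Matrix.of ρ)) := by
      rw [← Matrix.linearIndependent_rows_iff_isUnit]
      have hrow : ((eval v₀).mapMatrix
          (Matrix.of ρ)).row = fun j => (e j : Fin n → k) := by
        funext j
        rw [← hρe]
        rfl
      rw [hrow]
      exact hBli.comp e e.injective
    exact ((Matrix.isUnit_iff_isUnit_det _).1 hu).ne_zero
  · intro v t ht
    funext j
    exact hc j v t ht

theorem aux_tangent_local {n : ℕ} (hn : 5 ≤ n) {I : Ideal (MvPolynomial (Fin n) k)}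
    (hI : IsProjCurveIdeal I) (v₀ : Fin n → k)
    (hT : Module.finrank k (tangentSpace I v₀) = 2) :
    ∃ D G : MvPolynomial (Fin n) k, eval v₀ D ≠ 0 ∧ G ≠ 0 ∧
      ∀ v ∈ projZeros I, eval v D ≠ 0 → ∀ t ∈ tangentSpace I v, eval t G = 0 := by
  have hIp := hI.prime
  obtain ⟨b, hb⟩ := aux_noether hI
  obtain ⟨M, ℓ, c, hdet, hM⟩ := aux_rows v₀ hT
  let ι : MvPolynomial (Fin n) k ⧸ I →ₐ[k] MvPolynomial (Fin 2) (MvPolynomial (Fin n) k ⧸ I) :=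
    IsScalarTower.toAlgHom k _ _
  let m := Ideal.Quotient.mkₐ k I
  let w : Fin n → MvPolynomial (Fin 2) (MvPolynomial (Fin n) k ⧸ I) := fun i =>
    ∑ j, ι (m (M.adjugate i j)) * ∑ e, algebraMap k _ (c j e) * X e
  let b' : Fin 4 → MvPolynomial (Fin 2) (MvPolynomial (Fin n) k ⧸ I) :=
    Sum.elim (fun i => ι (b i)) (fun i => X i) ∘ (finSumFinEquiv (m := 2) (n := 2)).symm
  obtain ⟨G, hG, hG0⟩ := aux_dependent (k := k) b' (Set.range ι ∪ Set.range X) (by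
      rw [eq_top_iff]
      rintro f -
      induction f using MvPolynomial.induction_on with
      | C a => exact Algebra.subset_adjoin (R := k) (Or.inl ⟨a, rfl⟩)
      | add f g hf hg => exact add_mem hf hg
      | mul_X f i hf => exact mul_mem hf (Algebra.subset_adjoin (R := k) (Or.inr ⟨i, rfl⟩))) (by
      rintro _ (⟨s, rfl⟩ | ⟨i, rfl⟩)
      · refine aux_int_map ι (Set.range b) (Set.range b') ?_ s (hb s)
        rintro _ ⟨j, rfl⟩
        exact Algebra.subset_adjoin ⟨finSumFinEquiv (m := 2) (n := 2) (Sum.inl j), by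
              simp only [b', Function.comp, Equiv.symm_apply_apply, Sum.elim_inl]⟩
      · have hmem : (X i : MvPolynomial (Fin 2) (MvPolynomial (Fin n) k ⧸ I)) ∈
            Algebra.adjoin k (Set.range b') :=
          Algebra.subset_adjoin ⟨finSumFinEquiv (m := 2) (n := 2) (Sum.inr i), by
              simp only [b', Function.comp, Equiv.symm_apply_apply, Sum.elim_inr]⟩
        exact aux_int_mem _ _ hmem) n hn w
  refine ⟨M.det, G, hdet, hG, ?_⟩
  intro v hv hD t ht
  set t' : Fin n → k := (eval v M.det)⁻¹ • t with ht'
  have ht'm : t' ∈ tangentSpace I v := Submodule.smul_mem _ _ ht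
  let evS : MvPolynomial (Fin n) k ⧸ I →ₐ[k] k :=
    Ideal.Quotient.liftₐ I (aeval v) (fun f hf => by
      simpa [aeval_eq_eval] using hv f hf)
  have hevS : ∀ f, evS (m f) = eval v f := by
    intro f
    change aeval v f = _
    rw [aeval_eq_eval]
  let Θ : MvPolynomial (Fin 2) (MvPolynomial (Fin n) k ⧸ I) →+* k :=
    eval₂Hom evS.toRingHom (ℓ.mulVec t')
  have hΘι : ∀ s, Θ (ι s) = evS s := by
    intro s
    exact eval₂Hom_C _ _ _
  have hΘX : ∀ e, Θ (X e) = (ℓ.mulVec t') e := fun e => eval₂Hom_X' _ _ _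
  have hΘk : ∀ a : k, Θ (algebraMap k _ a) = a := by
    intro a
    have := hΘι (algebraMap k _ a)
    rw [AlgHom.commutes, AlgHom.commutes] at this
    exact this
  let Θ' : MvPolynomial (Fin 2) (MvPolynomial (Fin n) k ⧸ I) →ₐ[k] k :=
    { Θ with commutes' := hΘk }
  have hw : ∀ i, Θ' (w i) = t i := by
    intro i
    change Θ (w i) = t i
    have h1 := hM v t' ht'm
    have h2 := congrArg (((eval v).mapMatrix M).adjugate.mulVec) h1
    rw [Matrix.mulVec_mulVec, Matrix.adjugate_mul, ← RingHom.map_det, ← RingHom.map_adjugate,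
      Matrix.smul_mulVec, Matrix.one_mulVec, ht', smul_smul, mul_inv_cancel₀ hD, one_smul, ← ht'] at h2
    rw [h2]
    simp only [w, map_sum, map_mul, hΘι, hevS, hΘX, hΘk]
    rfl
  have e : Θ'.comp (aeval w) = aeval t := by ext i; simp [hw]
  have h3 : aeval t G = 0 := by
    rw [← e, AlgHom.comp_apply, hG0, map_zero]
  rwa [aeval_eq_eval] at h3

theorem aux_tangent {n : ℕ} (hn : 5 ≤ n) {I : Ideal (MvPolynomial (Fin n) k)}
    (hI : IsProjCurveIdeal I) (hsm : IsSmoothCurve I) :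
    ∃ G : MvPolynomial (Fin n) k, G ≠ 0 ∧
      ∀ v ∈ projZeros I, v ≠ 0 → ∀ t ∈ tangentSpace I v, eval t G = 0 := by
  let E : Set (MvPolynomial (Fin n) k) := {D | ∃ G : MvPolynomial (Fin n) k, G ≠ 0 ∧
    ∀ v ∈ projZeros I, eval v D ≠ 0 → ∀ t ∈ tangentSpace I v, eval t G = 0}
  obtain ⟨s, hsE, hspan⟩ := (Submodule.fg_span_iff_fg_span_finset_subset E).1
    (Ideal.fg_of_isNoetherianRing (Ideal.span E))
  choose! G hG hGv using (fun D (hD : D ∈ E) => hD)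
  refine ⟨∏ D ∈ s, G D, Finset.prod_ne_zero_iff.2 fun D hD => hG D (hsE hD), ?_⟩
  intro v hv hv0 t ht
  obtain ⟨D, G', hD, hG', hDG⟩ := aux_tangent_local hn hI v (hsm v hv hv0)
  have hex : ∃ D' ∈ s, eval v D' ≠ 0 := by
    by_contra hcon
    push Not at hcon
    apply hD
    have h1 : D ∈ Submodule.span (MvPolynomial (Fin n) k) (s : Set (MvPolynomial (Fin n) k)) := by
      rw [← hspan]
      exact Submodule.subset_span ⟨G', hG', hDG⟩
    have h2 : Ideal.span (s : Set (MvPolynomial (Fin n) k)) ≤ RingHom.ker (eval v) :=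
      Ideal.span_le.2 fun x hx => hcon x hx
    exact h2 h1
  obtain ⟨D', hD's, hD'v⟩ := hex
  rw [map_prod]
  exact Finset.prod_eq_zero hD's (hGv D' (hsE hD's) v hv hD'v t ht)

/-- A good centre of projection. -/
theorem aux_center [Infinite k] {n : ℕ} (hn : 4 ≤ n) {I : Ideal (MvPolynomial (Fin (n + 1)) k)}
    (hI : IsProjCurveIdeal I) (hsm : IsSmoothCurve I) :
    ∃ p : Fin (n + 1) → k, p (Fin.last n) = 1 ∧
      (∀ v ∈ projZeros I, ∀ w ∈ projZeros I, ∀ z : k, v - w = z • p → z = 0) ∧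
      ∀ v ∈ projZeros I, v ≠ 0 → p ∉ tangentSpace I v := by
  obtain ⟨F, hF, hFv⟩ := aux_secant (by omega) hI
  obtain ⟨G, hG, hGv⟩ := aux_tangent (by omega) hI hsm
  have hne : F * G * X (Fin.last n) ≠ 0 := mul_ne_zero (mul_ne_zero hF hG) (X_ne_zero _)
  have hp : ∃ p, eval p (F * G * X (Fin.last n)) ≠ 0 := by
    by_contra hcon
    push Not at hcon
    exact hne (MvPolynomial.funext fun p => by rw [hcon p, map_zero])
  obtain ⟨p, hp⟩ := hp
  rw [map_mul, map_mul, eval_X] at hp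
  have hpl := right_ne_zero_of_mul hp
  have hpF := left_ne_zero_of_mul (left_ne_zero_of_mul hp)
  have hpG := right_ne_zero_of_mul (left_ne_zero_of_mul hp)
  have hscale : ∀ (a : k) v, v ∈ projZeros I → a • v ∈ projZeros I := by
    intro a v hv f hf
    have h1 := aux_kill hI.homog (aeval (a • v) : MvPolynomial (Fin (n + 1)) k →ₐ[k] k) (by
      intro e f hf hfe
      have h2 := aux_aeval_scale hfe a v
      have h3 := hv f hf
      rw [← aeval_eq_eval] at h3
      rw [show aeval v f = 0 from h3, mul_zero] at h2
      exact h2) f hf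
    rwa [aeval_eq_eval] at h1
  refine ⟨(p (Fin.last n))⁻¹ • p, ?_, ?_, ?_⟩
  · simp [inv_mul_cancel₀ hpl]
  · intro v hv w hw z h
    by_contra hz
    apply hpF
    have hpv : p = fun i => ((z⁻¹ * p (Fin.last n)) • v) i - ((z⁻¹ * p (Fin.last n)) • w) i := by
      have : p = (z⁻¹ * p (Fin.last n)) • (v - w) := by
        rw [h, smul_smul, smul_smul]
        have h1 : z⁻¹ * p (Fin.last n) * (z * (p (Fin.last n))⁻¹) = 1 := by field_simp
        rw [← mul_assoc] at h1
        rw [h1, one_smul]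
      conv_lhs => rw [this, smul_sub]
      rfl
    rw [hpv]
    exact hFv _ (hscale _ v hv) _ (hscale _ w hw)
  · intro v hv hv0 ht
    apply hpG
    apply hGv v hv hv0
    have := Submodule.smul_mem _ (p (Fin.last n)) ht
    rwa [smul_smul, mul_inv_cancel₀ hpl, one_smul] at this


theorem aux_coeff_mem {A S : Type} [CommRing A] [CommRing S] [Algebra A S] (ε : A →+* k) (z : S)
    (P : Polynomial A) (hP : P.map ε = 0) :
    Polynomial.aeval z P ∈ (RingHom.ker ε).map (algebraMap A S) := by
  rw [Polynomial.aeval_eq_sum_range]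
  refine Ideal.sum_mem _ fun i _ => ?_
  rw [Algebra.smul_def]
  refine Ideal.mul_mem_right _ _ (Ideal.mem_map_of_mem _ ?_)
  have := congrArg (fun Q => Polynomial.coeff Q i) hP
  simpa [Polynomial.coeff_map] using this

theorem aux_nounit {A S : Type} [CommRing A] [CommRing S] [Algebra A S] [Module.Finite A S]
    (ε : A →+* k) (z : S) (P : Polynomial A) (hP : Polynomial.aeval z P = 0)
    (hP1 : P.map ε = 1) : ∃ r, ε r = 1 ∧ algebraMap A S r = 0 := by
  have h1 : (1 : S) ∈ (RingHom.ker ε).map (algebraMap A S) := by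
    have := aux_coeff_mem ε z (1 - P) (by rw [Polynomial.map_sub, hP1]; simp)
    rwa [map_sub, map_one, hP, sub_zero] at this
  obtain ⟨r, hr, hr0⟩ := Submodule.exists_sub_one_mem_and_smul_eq_zero_of_fg_of_le_smul
    (RingHom.ker ε) (⊤ : Submodule A S) Module.Finite.fg_top (by
      rw [Ideal.smul_top_eq_map, (Ideal.eq_top_iff_one _).2 h1]
      simp)
  refine ⟨r, ?_, ?_⟩
  · have : ε (r - 1) = 0 := hr
    rw [map_sub, map_one, sub_eq_zero] at this
    exact this
  · have := hr0 1 trivial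
    rwa [Algebra.smul_def, mul_one] at this

open scoped Pointwise in
theorem aux_local {A S : Type} [CommRing A] [CommRing S] [Algebra A S] [Module.Finite A S]
    (ε : A →+* k) (z : S) (hz : Function.Surjective (Polynomial.aeval z : Polynomial A →ₐ[A] S))
    (P : Polynomial A) (hP : Polynomial.aeval z P = 0) (y : A)
    (hP1 : P.map ε = Polynomial.X - Polynomial.C (ε y)) :
    ∃ s, ε s = 1 ∧ ∀ x : S, ∃ c, algebraMap A S s * x = algebraMap A S c := by
  have h1 : z - algebraMap A S y ∈ (RingHom.ker ε).map (algebraMap A S) := by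
    have := aux_coeff_mem ε z (Polynomial.X - Polynomial.C y - P) (by
      rw [Polynomial.map_sub, hP1]; simp)
    rwa [map_sub, hP, sub_zero, map_sub, Polynomial.aeval_X, Polynomial.aeval_C] at this
  obtain ⟨r, hr, hr0⟩ := Submodule.exists_sub_one_mem_and_smul_le_of_fg_of_le_sup
    (I := RingHom.ker ε) (N := LinearMap.range (Algebra.linearMap A S))
    (N' := (⊤ : Submodule A S)) (P := ⊤) Module.Finite.fg_top le_rfl (by
      rw [Ideal.smul_top_eq_map]
      rintro x -
      obtain ⟨Q, rfl⟩ := hz x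
      obtain ⟨T, hT⟩ := Polynomial.X_sub_C_dvd_sub_C_eval (a := y) (p := Q)
      have h2 := congrArg (Polynomial.aeval z) hT
      rw [map_mul, map_sub, map_sub, Polynomial.aeval_X, Polynomial.aeval_C,
        Polynomial.aeval_C, sub_eq_iff_eq_add'] at h2
      rw [h2]
      exact Submodule.add_mem_sup ⟨_, rfl⟩ (Ideal.mul_mem_right _ _ h1))
  refine ⟨r, ?_, fun x => ?_⟩
  · have : ε (r - 1) = 0 := hr
    rw [map_sub, map_one, sub_eq_zero] at this
    exact this
  · obtain ⟨c, hc⟩ := hr0 (Submodule.smul_mem_pointwise_smul x r ⊤ trivial)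
    refine ⟨c, ?_⟩
    rw [← Algebra.smul_def]
    exact hc.symm

theorem aux_finite {A S : Type} [CommRing A] [CommRing S] [Algebra A S] (z : S)
    (hz : Function.Surjective (Polynomial.aeval z : Polynomial A →ₐ[A] S))
    (P : Polynomial A) (hPm : P.Monic) (hP : Polynomial.aeval z P = 0) : Module.Finite A S := by
  have h1 : IsIntegral A z := ⟨P, hPm, hP⟩
  have h2 := h1.fg_adjoin_singleton
  have h3 : Algebra.adjoin A {z} = ⊤ := by
    rw [Algebra.adjoin_singleton_eq_range_aeval, AlgHom.range_eq_top]
    exact hz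
  rw [h3, Algebra.top_toSubmodule] at h2
  exact ⟨h2⟩

/-- Leading coefficient of `f(y + p Z)` in `Z`. -/
theorem aux_lead {A : Type} [CommRing A] [Algebra k A] {N : ℕ} (y : Fin N → A) (p : Fin N → k)
    {f : MvPolynomial (Fin N) k} {d : ℕ} (hf : f.IsHomogeneous d) :
    (aeval (fun j => Polynomial.C (y j) + Polynomial.C (algebraMap k A (p j)) * Polynomial.X) f).natDegree ≤ d ∧
    (aeval (fun j => Polynomial.C (y j) + Polynomial.C (algebraMap k A (p j)) * Polynomial.X) f).coeff d
      = algebraMap k A (eval p f) := by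
  set L : MvPolynomial (Fin N) k →ₐ[k] Polynomial A :=
    aeval (fun j => Polynomial.C (y j) + Polynomial.C (algebraMap k A (p j)) * Polynomial.X) with hL
  have hmon : ∀ m : Fin N →₀ ℕ, (L (monomial m 1)).natDegree ≤ m.degree ∧
      (L (monomial m 1)).coeff m.degree = algebraMap k A (eval p (monomial m 1)) := by
    intro m
    induction m using Finsupp.induction_linear with
    | zero => simp [show (monomial (0 : Fin N →₀ ℕ) (1 : k)) = 1 from rfl]
    | add m₁ m₂ h₁ h₂ =>
      have e : (monomial (m₁ + m₂) (1 : k)) = monomial m₁ 1 * monomial m₂ 1 := by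
        rw [monomial_mul, one_mul]
      rw [e, map_mul, map_add]
      refine ⟨Polynomial.natDegree_mul_le_of_le h₁.1 h₂.1, ?_⟩
      rw [Polynomial.coeff_mul_add_eq_of_natDegree_le h₁.1 h₂.1, h₁.2, h₂.2, map_mul, map_mul]
    | single i e =>
      have e : (monomial (Finsupp.single i e) (1 : k)) = X i ^ e := by
        rw [X_pow_eq_monomial]
      have h1 : (L (X i)).natDegree ≤ 1 := by
        rw [hL, aeval_X, add_comm]
        exact Polynomial.natDegree_linear_le
      have h2 : (L (X i)).coeff 1 = algebraMap k A (p i) := by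
        simp [hL, Polynomial.coeff_C]
      rw [e, map_pow, Finsupp.degree_single]
      refine ⟨?_, ?_⟩
      · have := Polynomial.natDegree_pow_le_of_le ‹ℕ› h1
        rwa [mul_one] at this
      · have := Polynomial.coeff_pow_of_natDegree_le (m := ‹ℕ›) h1
        rw [mul_one] at this
        rw [this, h2, map_pow, eval_X, map_pow]
  have hsum : f = ∑ m ∈ f.support, C (coeff m f) * monomial m 1 := by
    conv_lhs => rw [f.as_sum]
    refine Finset.sum_congr rfl fun m _ => ?_
    rw [C_mul_monomial, mul_one]
  have hLC : ∀ c : k, L (C c) = Polynomial.C (algebraMap k A c) := by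
    intro c
    exact L.commutes c
  have hdeg : ∀ m ∈ f.support, m.degree = d := by
    intro m hm
    have := hf (mem_support_iff.1 hm)
    rwa [Finsupp.degree_eq_weight_one]
  constructor
  · rw [hsum, map_sum]
    refine Polynomial.natDegree_sum_le_of_forall_le _ _ fun m hm => ?_
    rw [map_mul, hLC]
    refine (Polynomial.natDegree_C_mul_le _ _).trans ?_
    rw [← hdeg m hm]
    exact (hmon m).1
  · conv_lhs => rw [hsum, map_sum]
    conv_rhs => rw [hsum, map_sum, map_sum]
    rw [Polynomial.finsetSum_coeff]
    refine Finset.sum_congr rfl fun m hm => ?_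
    rw [map_mul, hLC, Polynomial.coeff_C_mul, map_mul, map_mul, eval_C, ← (hmon m).2, hdeg m hm]


theorem aux_scale {N : ℕ} {I : Ideal (MvPolynomial (Fin N) k)} (hI : IsProjCurveIdeal I) (a : k)
    (v : Fin N → k) (hv : v ∈ projZeros I) : a • v ∈ projZeros I := by
  intro f hf
  have h1 := aux_kill hI.homog (aeval (a • v) : MvPolynomial (Fin N) k →ₐ[k] k) (by
    intro e f hf hfe
    have h2 := aux_aeval_scale hfe a v
    have h3 := hv f hf
    rw [← aeval_eq_eval] at h3
    rw [show aeval v f = 0 from h3, mul_zero] at h2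
    exact h2) f hf
  rwa [aeval_eq_eval] at h1

/-- The matrix of the projection from `p` (with `p_last = 1`) to the first `n` coordinates. -/
def projMat {n : ℕ} (p : Fin (n + 1) → k) : Matrix (Fin n) (Fin (n + 1)) k :=
  fun i => Fin.lastCases (-p i.castSucc) (fun j => if i = j then 1 else 0)

theorem linForm_projMat {n : ℕ} (p : Fin (n + 1) → k) (i : Fin n) :
    linForm (projMat p) i = X i.castSucc - C (p i.castSucc) * X (Fin.last n) := by
  simp [linForm, projMat, Fin.sum_univ_castSucc, sub_eq_add_neg]

theorem projMat_mulVec {n : ℕ} (p v : Fin (n + 1) → k) (i : Fin n) :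
    (projMat p).mulVec v i = v i.castSucc - p i.castSucc * v (Fin.last n) := by
  rw [← eval_linForm, linForm_projMat]
  simp

/-- The point with last coordinate `z` over `q`. -/
def projPt {n : ℕ} (p : Fin (n + 1) → k) (q : Fin n → k) (z : k) : Fin (n + 1) → k :=
  Fin.lastCases z (fun i => q i + p i.castSucc * z)

theorem projMat_projPt {n : ℕ} (p : Fin (n + 1) → k) (q : Fin n → k) (z : k) :
    (projMat p).mulVec (projPt p q z) = q := by
  funext i
  rw [projMat_mulVec]
  simp [projPt]

theorem projMat_self {n : ℕ} (p : Fin (n + 1) → k) (hp : p (Fin.last n) = 1) :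
    (projMat p).mulVec p = 0 := by
  funext i
  rw [projMat_mulVec, hp]
  simp

theorem projPt_sub {n : ℕ} (p : Fin (n + 1) → k) (hp : p (Fin.last n) = 1) (q : Fin n → k)
    (z z' : k) : projPt p q z - projPt p q z' = (z - z') • p := by
  funext j
  refine Fin.lastCases ?_ (fun i => ?_) j
  · simp [projPt, hp]
  · simp [projPt]
    ring

/-- The coordinate ring of the big space as polynomials in the last variable over the small one. -/
noncomputable def projE {n : ℕ} (p : Fin (n + 1) → k) :
    Polynomial (MvPolynomial (Fin n) k) →+* MvPolynomial (Fin (n + 1)) k :=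
  Polynomial.eval₂RingHom (bind₁ (linForm (projMat p))).toRingHom (X (Fin.last n))

noncomputable def projL {n : ℕ} (p : Fin (n + 1) → k) :
    MvPolynomial (Fin (n + 1)) k →ₐ[k] Polynomial (MvPolynomial (Fin n) k) :=
  aeval (fun j => Polynomial.C ((Fin.lastCases 0 (fun i => X i) j : MvPolynomial (Fin n) k)) +
    Polynomial.C (algebraMap k (MvPolynomial (Fin n) k) (p j)) * Polynomial.X)

theorem projE_C {n : ℕ} (p : Fin (n + 1) → k) (g : MvPolynomial (Fin n) k) :
    projE p (Polynomial.C g) = bind₁ (linForm (projMat p)) g := by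
  simp [projE]

theorem projE_X {n : ℕ} (p : Fin (n + 1) → k) :
    projE p Polynomial.X = X (Fin.last n) := by
  simp [projE]

theorem projE_projL {n : ℕ} (p : Fin (n + 1) → k) (hp : p (Fin.last n) = 1)
    (f : MvPolynomial (Fin (n + 1)) k) : projE p (projL p f) = f := by
  have : (projE p).comp (projL p).toRingHom = RingHom.id _ := by
    apply MvPolynomial.ringHom_ext
    · intro r
      have h1 : (projL p) (C r) = Polynomial.C (C r) := (projL p).commutes r
      change projE p (projL p (C r)) = C r
      rw [h1, projE_C, bind₁_C_right]
    · intro j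
      change projE p (projL p (X j)) = X j
      rw [projL, aeval_X, map_add, map_mul, projE_C, projE_C, projE_X]
      refine Fin.lastCases ?_ (fun i => ?_) j
      · rw [hp]; simp
      · simp only [Fin.lastCases_castSucc, bind₁_X_right, linForm_projMat, algebraMap_eq,
          bind₁_C_right]
        ring
  exact congrArg (fun h => h f) this

theorem eval_projE {n : ℕ} (p : Fin (n + 1) → k) (q : Fin n → k) (z : k)
    (P : Polynomial (MvPolynomial (Fin n) k)) :
    eval (projPt p q z) (projE p P) = (P.map (eval q)).eval z := by
  have : (eval (projPt p q z)).comp (projE p) =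
      (Polynomial.evalRingHom z).comp (Polynomial.mapRingHom (eval q)) := by
    apply Polynomial.ringHom_ext
    · intro g
      simp only [RingHom.comp_apply, projE_C, eval_bind_linForm, projMat_projPt]
      simp
    · simp only [RingHom.comp_apply, projE_X, eval_X]
      simp [projPt]
  exact congrArg (fun h => h P) this

theorem dualPt_projE {n : ℕ} (p : Fin (n + 1) → k) (hp : p (Fin.last n) = 1)
    (q : Fin n → k) (z : k) (P : Polynomial (MvPolynomial (Fin n) k)) :
    dualPt (projPt p q z) p (projE p P) =
      Polynomial.aeval (TrivSqZeroExt.inl z + TrivSqZeroExt.inr 1 : TrivSqZeroExt k k)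
        (P.map (eval q)) := by
  have : (dualPt (projPt p q z) p).toRingHom.comp (projE p) =
      (Polynomial.aeval (TrivSqZeroExt.inl z + TrivSqZeroExt.inr 1 : TrivSqZeroExt k k)).toRingHom.comp
        (Polynomial.mapRingHom (eval q)) := by
    apply Polynomial.ringHom_ext
    · intro g
      change dualPt _ _ (projE p (Polynomial.C g)) =
        Polynomial.aeval _ (Polynomial.map (eval q) (Polynomial.C g))
      rw [projE_C, dualPt_bind_linForm, projMat_projPt, projMat_self p hp, Polynomial.map_C,
        Polynomial.aeval_C]
      apply TrivSqZeroExt.ext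
      · rw [fst_dualPt]; rfl
      · rw [snd_dualPt]; simp [TrivSqZeroExt.algebraMap_eq_inl]
    · change dualPt _ _ (projE p Polynomial.X) =
        Polynomial.aeval _ (Polynomial.map (eval q) Polynomial.X)
      rw [projE_X, Polynomial.map_X, Polynomial.aeval_X]
      simp [dualPt, projPt, hp]
  exact congrArg (fun h => h P) this

theorem aux_step [IsAlgClosed k] {n : ℕ} {I : Ideal (MvPolynomial (Fin (n + 1)) k)}
    (hI : IsProjCurveIdeal I) (hsm : IsSmoothCurve I) (p : Fin (n + 1) → k)
    (hp : p (Fin.last n) = 1)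
    (hsec : ∀ v ∈ projZeros I, ∀ w ∈ projZeros I, ∀ z : k, v - w = z • p → z = 0)
    (htan : ∀ v ∈ projZeros I, v ≠ 0 → p ∉ tangentSpace I v) :
    ∃ J : Ideal (MvPolynomial (Fin n) k), IsProjCurveIdeal J ∧ IsSmoothCurve J ∧ LinEmb I J := by
  have hIp := hI.prime
  have hpV : p ∉ projZeros I := by
    intro h
    have := hsec p h (0 • p) (aux_scale hI 0 p h) 1 (by simp)
    exact one_ne_zero this
  obtain ⟨d, f, hfI, hfd, hfp⟩ : ∃ d f, f ∈ I ∧ f.IsHomogeneous d ∧ eval p f ≠ 0 := by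
    by_contra hcon
    push Not at hcon
    apply hpV
    intro f hf
    have := aux_kill hI.homog (aeval p : MvPolynomial (Fin (n + 1)) k →ₐ[k] k) (by
      intro e f hf hfe
      rw [aeval_eq_eval]
      exact hcon e f hf hfe) f hf
    rwa [aeval_eq_eval] at this
  obtain ⟨P₀, hP₀m, hP₀I⟩ : ∃ P₀ : Polynomial (MvPolynomial (Fin n) k),
      P₀.Monic ∧ projE p P₀ ∈ I := by
    refine ⟨projL p (C (eval p f)⁻¹ * f), ?_, ?_⟩
    · have hh : (C (eval p f)⁻¹ * f).IsHomogeneous d := by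
        have := (isHomogeneous_C (Fin (n + 1)) (eval p f)⁻¹).mul hfd
        rwa [zero_add] at this
      obtain ⟨h1, h2⟩ := aux_lead
        (fun j => (Fin.lastCases 0 (fun i => X i) j : MvPolynomial (Fin n) k)) p hh
      refine Polynomial.monic_of_natDegree_le_of_coeff_eq_one d h1 (h2.trans ?_)
      rw [map_mul, eval_C, inv_mul_cancel₀ hfp, map_one]
    · rw [projE_projL p hp]
      exact I.mul_mem_left _ hfI
  let ψ : MvPolynomial (Fin n) k →+* MvPolynomial (Fin (n + 1)) k ⧸ I :=
    (Ideal.Quotient.mk I).comp (bind₁ (linForm (projMat p))).toRingHom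
  let _ : Algebra (MvPolynomial (Fin n) k) (MvPolynomial (Fin (n + 1)) k ⧸ I) := ψ.toAlgebra
  let zb : MvPolynomial (Fin (n + 1)) k ⧸ I := Ideal.Quotient.mk I (X (Fin.last n))
  have hae : ∀ P : Polynomial (MvPolynomial (Fin n) k),
      Polynomial.aeval zb P = Ideal.Quotient.mk I (projE p P) := by
    intro P
    have : (Polynomial.aeval (R := MvPolynomial (Fin n) k) zb).toRingHom =
        (Ideal.Quotient.mk I).comp (projE p) := by
      apply Polynomial.ringHom_ext
      · intro g
        change Polynomial.aeval zb (Polynomial.C g) = Ideal.Quotient.mk I (projE p (Polynomial.C g))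
        rw [Polynomial.aeval_C, projE_C]
        rfl
      · change Polynomial.aeval zb Polynomial.X = Ideal.Quotient.mk I (projE p Polynomial.X)
        rw [Polynomial.aeval_X, projE_X]
    exact congrArg (fun h => h P) this
  have hsurj : Function.Surjective
      (Polynomial.aeval zb : Polynomial (MvPolynomial (Fin n) k) →ₐ[_] _) := by
    intro y
    obtain ⟨f, rfl⟩ := Ideal.Quotient.mk_surjective y
    exact ⟨projL p f, by rw [hae, projE_projL p hp]⟩
  have hfin :=
    aux_finite zb hsurj P₀ hP₀m (by rw [hae]; exact Ideal.Quotient.eq_zero_iff_mem.2 hP₀I)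
  refine aux_emb hI hsm (projMat p) ?_ ?_
  · have : ψ.Finite := hfin
    exact this.to_isIntegral
  intro q hq hq0
  have hmsurj : Function.Surjective (Polynomial.mapRingHom (eval q)) :=
    Polynomial.map_surjective _ (fun c => ⟨C c, eval_C c⟩)
  let 𝔥 : Ideal (Polynomial k) := (I.comap (projE p)).map (Polynomial.mapRingHom (eval q))
  have hmem : ∀ x, x ∈ 𝔥 ↔ ∃ P, projE p P ∈ I ∧ P.map (eval q) = x := by
    intro x
    rw [Ideal.mem_map_iff_of_surjective _ hmsurj]
    rfl
  have h𝔥1 : (1 : Polynomial k) ∉ 𝔥 := by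
    intro h1
    obtain ⟨P, hPI, hP1⟩ := (hmem 1).1 h1
    obtain ⟨r, hr1, hr0⟩ := aux_nounit (eval q) zb P
      (by rw [hae]; exact Ideal.Quotient.eq_zero_iff_mem.2 hPI) hP1
    have : eval q r = 0 := hq r (Ideal.Quotient.eq_zero_iff_mem.1 hr0)
    rw [hr1] at this
    exact one_ne_zero this
  obtain ⟨h, hh⟩ : ∃ h, 𝔥 = Ideal.span {h} := (IsPrincipalIdealRing.principal 𝔥).principal
  have hdvd : ∀ x, x ∈ 𝔥 ↔ h ∣ x := by
    intro x
    rw [hh, Ideal.mem_span_singleton]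
  have hh0 : h ≠ 0 := by
    rintro rfl
    have h1 := (hdvd _).1 ((hmem _).2 ⟨P₀, hP₀I, rfl⟩)
    exact (hP₀m.map (eval q)).ne_zero (zero_dvd_iff.1 h1)
  have hhu : ¬ IsUnit h := fun hu => h𝔥1 ((hdvd 1).2 hu.dvd)
  have hmaps : ∀ f ∈ I, h ∣ (projL p f).map (eval q) := by
    intro f hf
    rw [← hdvd, hmem]
    exact ⟨projL p f, by rwa [projE_projL p hp], rfl⟩
  have hroot : ∀ z, h.IsRoot z → projPt p q z ∈ projZeros I := by
    intro z hz f hf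
    rw [← projE_projL p hp f, eval_projE]
    obtain ⟨g, hg⟩ := hmaps f hf
    rw [hg, Polynomial.eval_mul, hz.eq_zero, zero_mul]
  have hpt0 : ∀ z, projPt p q z ≠ 0 := by
    intro z h0
    apply hq0
    rw [← projMat_projPt p q z, h0, Matrix.mulVec_zero]
  obtain ⟨z₀, hz₀⟩ := IsAlgClosed.exists_root h (fun hd => hhu (Polynomial.isUnit_iff_degree_eq_zero.2 hd))
  obtain ⟨g, hg⟩ := Polynomial.dvd_iff_isRoot.2 hz₀
  have hgu : IsUnit g := by
    by_contra hgu
    obtain ⟨z₁, hz₁⟩ := IsAlgClosed.exists_root g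
      (fun hd => hgu (Polynomial.isUnit_iff_degree_eq_zero.2 hd))
    have hz₁h : h.IsRoot z₁ := by
      rw [hg, Polynomial.IsRoot, Polynomial.eval_mul, hz₁.eq_zero, mul_zero]
    have hzz : z₁ = z₀ := sub_eq_zero.1
      (hsec _ (hroot z₁ hz₁h) _ (hroot z₀ hz₀) _ (projPt_sub p hp q z₁ z₀))
    subst hzz
    obtain ⟨g', hg'⟩ := Polynomial.dvd_iff_isRoot.2 hz₁
    apply htan _ (hroot z₁ hz₁h) (hpt0 z₁)
    rw [mem_tangentSpace_iff _ _ _ (hroot z₁ hz₁h)]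
    intro f hf
    rw [← projE_projL p hp f, dualPt_projE p hp]
    obtain ⟨e, he⟩ := hmaps f hf
    rw [he, hg, hg']
    have hsq : Polynomial.aeval (TrivSqZeroExt.inl z₁ + TrivSqZeroExt.inr 1 : TrivSqZeroExt k k)
        (Polynomial.X - Polynomial.C z₁) = TrivSqZeroExt.inr 1 := by
      rw [map_sub, Polynomial.aeval_X, Polynomial.aeval_C, TrivSqZeroExt.algebraMap_eq_inl]
      simp
    rw [map_mul, map_mul, map_mul, hsq, ← mul_assoc, TrivSqZeroExt.inr_mul_inr, zero_mul, zero_mul]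
  have hlin : Polynomial.X - Polynomial.C z₀ ∈ 𝔥 := by
    rw [hdvd, hg]
    exact (hgu.mul_right_dvd).2 dvd_rfl
  obtain ⟨P, hPI, hP⟩ := (hmem _).1 hlin
  obtain ⟨s, hs, hc⟩ := aux_local (eval q) zb hsurj P
    (by rw [hae]; exact Ideal.Quotient.eq_zero_iff_mem.2 hPI) (C z₀) (by rw [hP, eval_C])
  choose c hc using fun j => hc (Ideal.Quotient.mk I (X j))
  refine ⟨s, c, by rw [hs]; exact one_ne_zero, fun j => ?_⟩
  rw [← Ideal.Quotient.eq_zero_iff_mem, map_sub, map_mul, sub_eq_zero]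
  exact hc j

theorem aux_main [IsAlgClosed k] (m : ℕ) : ∀ I : Ideal (MvPolynomial (Fin m) k),
    IsProjCurveIdeal I → IsSmoothCurve I →
    ∃ J : Ideal (MvPolynomial (Fin 4) k), IsProjCurveIdeal J ∧ IsSmoothCurve J ∧ LinEmb I J := by
  induction m with
  | zero => exact fun I hI hsm => aux_pad (by omega) hI hsm
  | succ n ih =>
    intro I hI hsm
    by_cases hn : n + 1 ≤ 4
    · exact aux_pad hn hI hsm
    · have : Infinite k := IsAlgClosed.instInfinite
      obtain ⟨p, hp, hsec, htan⟩ := aux_center (by omega) hI hsm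
      obtain ⟨J, hJ, hJs, hIJ⟩ := aux_step hI hsm p hp hsec htan
      obtain ⟨K, hK, hKs, hJK⟩ := ih J hJ hJs
      exact ⟨K, hK, hKs, hIJ.trans hJ.prime hJK⟩

/-- Every smooth projective curve over an algebraically closed field can
be embedded in `ℙ³`: given a smooth irreducible curve `C = V(I)` in any projective space
`ℙ^N`, there is a smooth irreducible curve in `ℙ³` birationally equivalent to it (and
birationally equivalent smooth projective curves are isomorphic). -/
theorem smooth_projective_curve_embeds_in_P3
    {k : Type} [Field k] [IsAlgClosed k]
    (N : ℕ) (I : Ideal (MvPolynomial (Fin (N + 1)) k))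
    (hI : IsProjCurveIdeal I) (hsm : IsSmoothCurve I) :
    ∃ J : Ideal (MvPolynomial (Fin 4) k),
      IsProjCurveIdeal J ∧ IsSmoothCurve J ∧ IdealBirEquiv I J := by
  obtain ⟨J, hJ, hJs, hIJ⟩ := aux_main (N + 1) I hI hsm
  exact ⟨J, hJ, hJs, hIJ.birEquiv hI.homog⟩
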